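/- There exists a universal constant C > 0 with the following property. Let ω : ℝ²₊ → ℝ be a bounded measurable function with ∫_{ℝ²₊} y_r²·|ω(y)| dy < ∞, and define u = (u_z, u_r) on ℝ²₊ by u_z(x) = −(1/(4π))·∫_{ℝ} dy_z ∫₀^∞ y_r² dy_r ∫_{−π}^{π} dθ · ω(y)·(x_r·cos θ − y_r)/[|x − y|² + 2·x_r·y_r·(1 − cos θ)]^{3/2} and u_r(x) = (1/(4π))·∫_{ℝ} dy_z ∫₀^∞ y_r² dy_r ∫_{−π}^{π} dθ · ω(y)·(x_z − y_z)·cos θ/[|x − y|² + 2·x_r·y_r·(1 − cos θ)]^{3/2}. Then for every x ∈ ℝ²₊, |u(x)| ≤ C·(∫_{ℝ²₊} y_r²·|ω(y)| dy)^{1/2}·(ess sup |ω|)^{1/2}. -/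

import Mathlib

open MeasureTheory

/-- The vertical component of the axisymmetric Biot–Savart law: a point
`x ∈ ℝ²₊` is written `x = (x_z, x_r)` with `x_r = x.2 > 0`. -/
noncomputable def uzBS (ω : ℝ × ℝ → ℝ) (x : ℝ × ℝ) : ℝ :=
  -(1/(4*Real.pi)) *
    ∫ yz : ℝ, ∫ yr in Set.Ioi (0:ℝ), ∫ θ in Set.Ioc (-Real.pi) Real.pi,
      yr^2 * ω (yz, yr) * (x.2 * Real.cos θ - yr) /
        (((x.1 - yz)^2 + (x.2 - yr)^2 + 2*x.2*yr*(1 - Real.cos θ)) ^ ((3:ℝ)/2))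

/-- The radial component of the axisymmetric Biot–Savart law. -/
noncomputable def urBS (ω : ℝ × ℝ → ℝ) (x : ℝ × ℝ) : ℝ :=
  (1/(4*Real.pi)) *
    ∫ yz : ℝ, ∫ yr in Set.Ioi (0:ℝ), ∫ θ in Set.Ioc (-Real.pi) Real.pi,
      yr^2 * ω (yz, yr) * (x.1 - yz) * Real.cos θ /
        (((x.1 - yz)^2 + (x.2 - yr)^2 + 2*x.2*yr*(1 - Real.cos θ)) ^ ((3:ℝ)/2))

/-- The open half-plane `ℝ²₊`. -/
def halfPlane : Set (ℝ × ℝ) := {y | 0 < y.2}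

lemma lintegral_inv_sq_add_sq_mul_sq {p q : ℝ} (hp : 0 < p) (hq : 0 < q) :
    ∫⁻ θ : ℝ, ENNReal.ofReal (2 / (p ^ 2 + q ^ 2 * θ ^ 2 / Real.pi ^ 2)) =
      ENNReal.ofReal (2 * Real.pi ^ 2 / (p * q)) := by
  have hπ := Real.pi_pos
  have hr : 0 < q / (p * Real.pi) := by positivity
  have heq : (fun θ : ℝ => 2 / (p ^ 2 + q ^ 2 * θ ^ 2 / Real.pi ^ 2)) =
      fun θ => 2 / p ^ 2 * (1 + (q / (p * Real.pi) * θ) ^ 2)⁻¹ := by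
    funext θ
    have : (1 + (q / (p * Real.pi) * θ) ^ 2) =
        (p ^ 2 + q ^ 2 * θ ^ 2 / Real.pi ^ 2) / p ^ 2 := by field_simp
    rw [this]
    have : 0 < p ^ 2 + q ^ 2 * θ ^ 2 / Real.pi ^ 2 := by positivity
    field_simp
  rw [← ofReal_integral_eq_lintegral_ofReal]
  · rw [heq, integral_const_mul,
      Measure.integral_comp_mul_left (fun t : ℝ => (1 + t ^ 2)⁻¹), integral_univ_inv_one_add_sq,
      abs_of_pos (inv_pos.2 hr), smul_eq_mul]
    congr 1
    field_simp
  · rw [heq]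
    exact (integrable_inv_one_add_sq.comp_mul_left' hr.ne').const_mul _
  · exact Filter.Eventually.of_forall fun θ => by positivity

/-- The function `|t|^{-1/2}` cut off to `[-ρ, ρ]`. -/
noncomputable def truncInvSqrt (ρ t : ℝ) : ℝ :=
  (Set.Iic ρ).indicator (fun u => u ^ (-(1 / 2) : ℝ)) |t|

lemma truncInvSqrt_nonneg (ρ t : ℝ) : 0 ≤ truncInvSqrt ρ t :=
  Set.indicator_apply_nonneg fun _ => Real.rpow_nonneg (abs_nonneg t) _

lemma measurable_truncInvSqrt (ρ : ℝ) : Measurable (truncInvSqrt ρ) := by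
  have : Measurable ((Set.Iic ρ).indicator (fun u : ℝ => u ^ (-(1 / 2) : ℝ))) :=
    (by fun_prop : Measurable (fun u : ℝ => u ^ (-(1 / 2) : ℝ))).indicator measurableSet_Iic
  exact this.comp measurable_norm

lemma integral_truncInvSqrt {ρ : ℝ} (hρ : 0 < ρ) :
    ∫ t, truncInvSqrt ρ t = 4 * Real.sqrt ρ := by
  unfold truncInvSqrt
  rw [integral_comp_abs, setIntegral_indicator measurableSet_Iic, Set.Ioi_inter_Iic,
    ← intervalIntegral.integral_of_le hρ.le, integral_rpow (Or.inl (by norm_num)),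
    Real.zero_rpow (by norm_num), Real.sqrt_eq_rpow]
  norm_num
  ring

lemma lintegral_truncInvSqrt {ρ : ℝ} (hρ : 0 < ρ) :
    ∫⁻ t, ENNReal.ofReal (truncInvSqrt ρ t) = ENNReal.ofReal (4 * Real.sqrt ρ) := by
  rw [← integral_truncInvSqrt hρ, ofReal_integral_eq_lintegral_ofReal]
  · refine Integrable.of_integral_ne_zero ?_
    rw [integral_truncInvSqrt hρ]
    positivity
  · exact Filter.Eventually.of_forall (truncInvSqrt_nonneg ρ)

lemma lintegral_truncInvSqrt_mul {ρ : ℝ} (hρ : 0 < ρ) (x : ℝ × ℝ) :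
    ∫⁻ y : ℝ × ℝ, ENNReal.ofReal (truncInvSqrt ρ (x.1 - y.1) * truncInvSqrt ρ (x.2 - y.2)) =
      ENNReal.ofReal (16 * ρ) := by
  have hm := measurable_truncInvSqrt ρ
  simp_rw [ENNReal.ofReal_mul (truncInvSqrt_nonneg ρ _)]
  rw [Measure.volume_eq_prod, lintegral_prod_mul
    (f := fun t => ENNReal.ofReal (truncInvSqrt ρ (x.1 - t)))
    (g := fun t => ENNReal.ofReal (truncInvSqrt ρ (x.2 - t)))
    (by fun_prop) (by fun_prop),
    lintegral_sub_left_eq_self (fun t => ENNReal.ofReal (truncInvSqrt ρ t)),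
    lintegral_sub_left_eq_self (fun t => ENNReal.ofReal (truncInvSqrt ρ t)),
    lintegral_truncInvSqrt hρ, ← ENNReal.ofReal_mul (by positivity)]
  congr 1
  nlinarith [Real.sq_sqrt hρ.le]

lemma inv_le_truncInvSqrt_mul {ρ a b : ℝ} (ha : a ≠ 0) (hb : b ≠ 0) (haρ : |a| ≤ ρ)
    (hbρ : |b| ≤ ρ) :
    1 / Real.sqrt (a ^ 2 + b ^ 2) ≤ truncInvSqrt ρ a * truncInvSqrt ρ b := by
  have ha' := abs_pos.2 ha
  have hb' := abs_pos.2 hb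
  rw [truncInvSqrt, truncInvSqrt, Set.indicator_of_mem (by exact haρ),
    Set.indicator_of_mem (by exact hbρ), ← Real.mul_rpow ha'.le hb'.le,
    Real.rpow_neg (by positivity), ← Real.sqrt_eq_rpow, one_div]
  gcongr
  rw [← sq_abs a, ← sq_abs b]
  nlinarith [sq_nonneg (|a| - |b|)]

/-- The weighted kernel `r² / (d d')`, with `d` the distance to a point at height `q` and `d'` the
distance to its mirror image, splits at scale `s` into a bounded part and a part supported near
the point. -/
lemma weighted_kernel_le {q r s a : ℝ} (hq : 0 < q) (hr : 0 < r) (hs : 0 < s) (ha : a ≠ 0)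
    (hb : q - r ≠ 0) :
    r ^ 2 / (Real.sqrt (a ^ 2 + (q - r) ^ 2) * Real.sqrt (a ^ 2 + (q + r) ^ 2)) ≤
      r ^ 2 / s ^ 2 + 2 * max q s *
        (truncInvSqrt (s ^ 2 / max q s) a * truncInvSqrt (s ^ 2 / max q s) (q - r)) := by
  set R := max q s with hR
  set ρ := s ^ 2 / R with hρ
  have hqR : q ≤ R := le_max_left _ _
  have hsR : s ≤ R := le_max_right _ _
  have hRpos : 0 < R := hq.trans_le hqR
  have hρR : ρ * R = s ^ 2 := by rw [hρ]; field_simp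
  have hρR' : ρ ≤ R := by rw [hρ, div_le_iff₀ hRpos]; nlinarith
  have hρpos : 0 < ρ := by positivity
  set d := Real.sqrt (a ^ 2 + (q - r) ^ 2) with hd
  set d' := Real.sqrt (a ^ 2 + (q + r) ^ 2) with hd'
  have hdpos : 0 < d := Real.sqrt_pos.2 (by positivity)
  have hd'q : q + r ≤ d' := Real.le_sqrt_of_sq_le (by nlinarith [sq_nonneg a])
  have hdd' : d ≤ d' := Real.sqrt_le_sqrt (by nlinarith [mul_pos hq hr])
  have hd'pos : 0 < d' := by linarith
  have hnn : 0 ≤ truncInvSqrt ρ a * truncInvSqrt ρ (q - r) :=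
    mul_nonneg (truncInvSqrt_nonneg _ _) (truncInvSqrt_nonneg _ _)
  by_cases hbox : |a| ≤ ρ ∧ |q - r| ≤ ρ
  · have h1 := inv_le_truncInvSqrt_mul ha hb hbox.1 hbox.2
    have hr2 : r ≤ 2 * R := by linarith [neg_le_of_abs_le hbox.2]
    calc r ^ 2 / (d * d') ≤ 2 * R * (1 / d) := by
          rw [mul_one_div, div_le_div_iff₀ (by positivity) hdpos]
          have : r ^ 2 ≤ 2 * R * d' := by nlinarith
          nlinarith
      _ ≤ 2 * R * (truncInvSqrt ρ a * truncInvSqrt ρ (q - r)) := by gcongr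
      _ ≤ _ := le_add_of_nonneg_left (by positivity)
  · have hdρ : ρ ≤ d := by
      rcases not_and_or.1 hbox with h | h
      · refine (not_le.1 h).le.trans (Real.le_sqrt_of_sq_le ?_)
        rw [sq_abs]; nlinarith [sq_nonneg (q - r)]
      · refine (not_le.1 h).le.trans (Real.le_sqrt_of_sq_le ?_)
        rw [sq_abs]; nlinarith [sq_nonneg a]
    have hs2 : s ^ 2 ≤ d * d' := by
      rcases max_cases q s with ⟨h, _⟩ | ⟨h, _⟩
      · rw [← hρR]
        have : R ≤ d' := by rw [hR, h]; linarith
        gcongr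
      · have hRs : R = s := h
        have : ρ = s := by rw [hρ, hRs]; field_simp
        nlinarith
    calc r ^ 2 / (d * d') ≤ r ^ 2 / s ^ 2 := by gcongr
      _ ≤ _ := le_add_of_nonneg_right (by positivity)

/-- Lower bound for the squared distance between rings at heights `q` and `r`. -/
lemma ring_dist_sq_ge {a q r θ : ℝ} (hq : 0 < q) (hr : 0 < r) (hθ : |θ| ≤ Real.pi) :
    (a ^ 2 + (q - r) ^ 2 + (a ^ 2 + (q + r) ^ 2) * θ ^ 2 / Real.pi ^ 2) / 2 ≤
      a ^ 2 + (q - r) ^ 2 + 2 * q * r * (1 - Real.cos θ) := by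
  have hπ := Real.pi_pos
  have h := Real.cos_le_one_sub_mul_cos_sq hθ
  have ht : θ ^ 2 / Real.pi ^ 2 ≤ 1 := by
    rw [div_le_one (by positivity), ← sq_abs θ]
    gcongr
  rw [mul_div_assoc]
  have h' : 2 * (θ ^ 2 / Real.pi ^ 2) ≤ 1 - Real.cos θ := by
    have : 2 / Real.pi ^ 2 * θ ^ 2 = 2 * (θ ^ 2 / Real.pi ^ 2) := by ring
    linarith
  have ht0 : 0 ≤ θ ^ 2 / Real.pi ^ 2 := by positivity
  generalize θ ^ 2 / Real.pi ^ 2 = t at *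
  nlinarith [mul_le_mul_of_nonneg_left h' (by positivity : 0 ≤ 2 * q * r),
    mul_nonneg (add_nonneg (sq_nonneg a) (sq_nonneg (q - r))) (sub_nonneg.2 ht),
    mul_nonneg (mul_pos hq hr).le ht0]

lemma abs_mul_div_rpow_three_halves_le {w k D : ℝ} (hD : 0 < D) (hk : k ^ 2 ≤ D) :
    |w * k / D ^ ((3 : ℝ) / 2)| ≤ |w| * (1 / D) := by
  have h3 : D ^ ((3 : ℝ) / 2) = D * Real.sqrt D := by
    rw [Real.sqrt_eq_rpow, ← Real.rpow_one_add' hD.le (by norm_num)]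
    norm_num
  have hsq : 0 < Real.sqrt D := Real.sqrt_pos.2 hD
  have hk' : |k| ≤ Real.sqrt D := Real.abs_le_sqrt hk
  rw [abs_div, abs_mul, h3, abs_of_pos (by positivity : 0 < D * Real.sqrt D), mul_one_div,
    div_le_div_iff₀ (by positivity) hD]
  calc |w| * |k| * D ≤ |w| * Real.sqrt D * D := by gcongr
    _ = |w| * (D * Real.sqrt D) := by ring

lemma lintegral_angular_le {a q r w : ℝ} (ha : a ≠ 0) (hq : 0 < q) (hr : 0 < r) (k : ℝ → ℝ)
    (hk : ∀ θ, k θ ^ 2 ≤ a ^ 2 + (q - r) ^ 2 + 2 * q * r * (1 - Real.cos θ)) :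
    ∫⁻ θ in Set.Ioc (-Real.pi) Real.pi,
        ‖w * k θ / (a ^ 2 + (q - r) ^ 2 + 2 * q * r * (1 - Real.cos θ)) ^ ((3 : ℝ) / 2)‖ₑ ≤
      ENNReal.ofReal (|w| * (2 * Real.pi ^ 2 /
        (Real.sqrt (a ^ 2 + (q - r) ^ 2) * Real.sqrt (a ^ 2 + (q + r) ^ 2)))) := by
  have hπ := Real.pi_pos
  have hd : 0 < Real.sqrt (a ^ 2 + (q - r) ^ 2) := Real.sqrt_pos.2 (by positivity)
  have hd' : 0 < Real.sqrt (a ^ 2 + (q + r) ^ 2) := Real.sqrt_pos.2 (by positivity)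
  rw [ENNReal.ofReal_mul (abs_nonneg w), ← lintegral_inv_sq_add_sq_mul_sq hd hd',
    ← lintegral_const_mul' _ _ ENNReal.ofReal_ne_top]
  refine le_trans (setLIntegral_mono_ae' measurableSet_Ioc ?_) (setLIntegral_le_lintegral _ _)
  refine Filter.Eventually.of_forall fun θ hθ => ?_
  rw [← ENNReal.ofReal_mul (abs_nonneg w), ← ofReal_norm, Real.norm_eq_abs]
  refine ENNReal.ofReal_le_ofReal ?_
  rw [Real.sq_sqrt (by positivity), Real.sq_sqrt (by positivity)]
  have hlow := ring_dist_sq_ge (a := a) hq hr (abs_le.2 ⟨hθ.1.le, hθ.2⟩)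
  have hpos : 0 < (a ^ 2 + (q - r) ^ 2 + (a ^ 2 + (q + r) ^ 2) * θ ^ 2 / Real.pi ^ 2) / 2 := by
    positivity
  refine (abs_mul_div_rpow_three_halves_le (hpos.trans_le hlow) (hk θ)).trans ?_
  refine mul_le_mul_of_nonneg_left ((one_div_le_one_div_of_le hpos hlow).trans_eq ?_) (abs_nonneg w)
  rw [one_div_div]

lemma measurableSet_halfPlane : MeasurableSet halfPlane :=
  measurableSet_lt measurable_const measurable_snd

lemma lintegral_halfPlane {f : ℝ × ℝ → ENNReal} (hf : Measurable f) :
    ∫⁻ y in halfPlane, f y = ∫⁻ yz : ℝ, ∫⁻ yr in Set.Ioi (0 : ℝ), f (yz, yr) := by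
  have h : halfPlane = Set.univ ×ˢ Set.Ioi (0 : ℝ) := by ext; simp [halfPlane]
  rw [h, Measure.volume_eq_prod, ← Measure.prod_restrict, Measure.restrict_univ,
    lintegral_prod _ hf.aemeasurable]

lemma le_mul_sqrt_of_forall_le {A M L b : ℝ} (hM : 0 ≤ M) (hL : 0 ≤ L) (hb : 0 ≤ b)
    (h : ∀ s > 0, A ≤ M / s ^ 2 + b * L * s ^ 2) :
    A ≤ (1 + b) * (Real.sqrt M * Real.sqrt L) := by
  have hlim : Filter.Tendsto (fun e : ℝ => Real.sqrt M * (Real.sqrt L + e) +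
      b * ((Real.sqrt M + e) * Real.sqrt L)) (nhdsWithin 0 (Set.Ioi 0))
      (nhds ((1 + b) * (Real.sqrt M * Real.sqrt L))) := by
    have : Continuous (fun e : ℝ => Real.sqrt M * (Real.sqrt L + e) +
      b * ((Real.sqrt M + e) * Real.sqrt L)) := by fun_prop
    convert (this.tendsto 0).mono_left nhdsWithin_le_nhds using 2
    ring
  refine ge_of_tendsto hlim (eventually_nhdsWithin_of_forall fun e (he : 0 < e) => ?_)
  have hm := Real.sqrt_nonneg M
  have hl := Real.sqrt_nonneg L
  have hme : 0 < Real.sqrt M + e := by positivity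
  have hle : 0 < Real.sqrt L + e := by positivity
  refine (h (Real.sqrt ((Real.sqrt M + e) / (Real.sqrt L + e))) (by positivity)).trans ?_
  rw [Real.sq_sqrt (by positivity)]
  refine add_le_add ?_ ?_
  · rw [div_div_eq_mul_div, div_le_iff₀ hme]
    nlinarith [mul_nonneg (mul_nonneg hm hle.le) he.le, Real.mul_self_sqrt hM]
  · rw [mul_assoc]
    refine mul_le_mul_of_nonneg_left ?_ hb
    rw [mul_div_assoc', div_le_iff₀ hle]
    nlinarith [mul_nonneg (mul_nonneg hl hme.le) he.le, Real.mul_self_sqrt hL]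

lemma lintegral_weighted_kernel_le {ω : ℝ × ℝ → ℝ} {L : ℝ}
    (hint : IntegrableOn (fun y => y.2 ^ 2 * |ω y|) halfPlane)
    (hL : 0 ≤ L) (hae : ∀ᵐ y ∂volume.restrict halfPlane, |ω y| ≤ L)
    {x : ℝ × ℝ} (hx : 0 < x.2) {s : ℝ} (hs : 0 < s) :
    ∫⁻ y in halfPlane, ENNReal.ofReal (|y.2 ^ 2 * ω y| * (2 * Real.pi ^ 2 /
        (Real.sqrt ((x.1 - y.1) ^ 2 + (x.2 - y.2) ^ 2) *
          Real.sqrt ((x.1 - y.1) ^ 2 + (x.2 + y.2) ^ 2)))) ≤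
      ENNReal.ofReal (2 * Real.pi ^ 2 *
        ((∫ y in halfPlane, y.2 ^ 2 * |ω y|) / s ^ 2 + 32 * L * s ^ 2)) := by
  set R := max x.2 s with hR
  set ρ := s ^ 2 / R with hρ
  have hRpos : 0 < R := lt_max_of_lt_left hx
  have hρpos : 0 < ρ := by positivity
  have hM : 0 ≤ ∫ y in halfPlane, y.2 ^ 2 * |ω y| := integral_nonneg fun y => by positivity
  have hne1 : ∀ᵐ y : ℝ × ℝ ∂volume.restrict halfPlane, y.1 ≠ x.1 :=
    ae_restrict_of_ae (Measure.quasiMeasurePreserving_fst.ae (Measure.ae_ne volume x.1))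
  have hne2 : ∀ᵐ y : ℝ × ℝ ∂volume.restrict halfPlane, y.2 ≠ x.2 :=
    ae_restrict_of_ae (Measure.quasiMeasurePreserving_snd.ae (Measure.ae_ne volume x.2))
  have hmeas := measurable_truncInvSqrt ρ
  calc _ ≤ ∫⁻ y in halfPlane, (ENNReal.ofReal (2 * Real.pi ^ 2 / s ^ 2) *
            ENNReal.ofReal (y.2 ^ 2 * |ω y|) +
          ENNReal.ofReal (2 * Real.pi ^ 2 * (2 * R) * L) * ENNReal.ofReal
            (truncInvSqrt ρ (x.1 - y.1) * truncInvSqrt ρ (x.2 - y.2))) := by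
        refine lintegral_mono_ae ?_
        filter_upwards [hae, hne1, hne2, ae_restrict_mem measurableSet_halfPlane]
          with y hy h1 h2 (h3 : 0 < y.2)
        have hnn : 0 ≤ truncInvSqrt ρ (x.1 - y.1) * truncInvSqrt ρ (x.2 - y.2) :=
          mul_nonneg (truncInvSqrt_nonneg _ _) (truncInvSqrt_nonneg _ _)
        rw [← ENNReal.ofReal_mul (by positivity), ← ENNReal.ofReal_mul (by positivity),
          ← ENNReal.ofReal_add (by positivity) (by positivity)]
        refine ENNReal.ofReal_le_ofReal ?_
        have hker := weighted_kernel_le hx h3 hs (sub_ne_zero.2 h1.symm) (sub_ne_zero.2 h2.symm)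
        rw [abs_mul, abs_of_nonneg (sq_nonneg y.2)]
        calc _ = 2 * Real.pi ^ 2 * |ω y| * (y.2 ^ 2 /
              (Real.sqrt ((x.1 - y.1) ^ 2 + (x.2 - y.2) ^ 2) *
                Real.sqrt ((x.1 - y.1) ^ 2 + (x.2 + y.2) ^ 2))) := by ring
          _ ≤ 2 * Real.pi ^ 2 * |ω y| * (y.2 ^ 2 / s ^ 2 + 2 * R *
              (truncInvSqrt ρ (x.1 - y.1) * truncInvSqrt ρ (x.2 - y.2))) := by gcongr
          _ = 2 * Real.pi ^ 2 / s ^ 2 * (y.2 ^ 2 * |ω y|) + 2 * Real.pi ^ 2 * (2 * R) * |ω y| *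
              (truncInvSqrt ρ (x.1 - y.1) * truncInvSqrt ρ (x.2 - y.2)) := by ring
          _ ≤ _ := by gcongr
    _ = ENNReal.ofReal (2 * Real.pi ^ 2 / s ^ 2) *
            (∫⁻ y in halfPlane, ENNReal.ofReal (y.2 ^ 2 * |ω y|)) +
          ENNReal.ofReal (2 * Real.pi ^ 2 * (2 * R) * L) * ∫⁻ y in halfPlane, ENNReal.ofReal
            (truncInvSqrt ρ (x.1 - y.1) * truncInvSqrt ρ (x.2 - y.2)) := by
        rw [lintegral_add_right _ (by fun_prop),
          lintegral_const_mul' _ _ ENNReal.ofReal_ne_top,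
          lintegral_const_mul' _ _ ENNReal.ofReal_ne_top]
    _ ≤ ENNReal.ofReal (2 * Real.pi ^ 2 / s ^ 2) *
            ENNReal.ofReal (∫ y in halfPlane, y.2 ^ 2 * |ω y|) +
          ENNReal.ofReal (2 * Real.pi ^ 2 * (2 * R) * L) * ENNReal.ofReal (16 * ρ) := by
        rw [ofReal_integral_eq_lintegral_ofReal hint
          (Filter.Eventually.of_forall fun y => by positivity),
          ← lintegral_truncInvSqrt_mul hρpos x]
        gcongr
        exact Measure.restrict_le_self
    _ = _ := by
        rw [← ENNReal.ofReal_mul (by positivity), ← ENNReal.ofReal_mul (by positivity),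
          ← ENNReal.ofReal_add (by positivity) (by positivity)]
        congr 1
        rw [hρ]
        field_simp
        ring

lemma abs_integral_biotSavart_le {ω : ℝ × ℝ → ℝ} {L : ℝ} (hω : Measurable ω)
    (hint : IntegrableOn (fun y => y.2 ^ 2 * |ω y|) halfPlane)
    (hL : 0 ≤ L) (hae : ∀ᵐ y ∂volume.restrict halfPlane, |ω y| ≤ L)
    {x : ℝ × ℝ} (hx : 0 < x.2) (k : ℝ → ℝ → ℝ → ℝ)
    (hk : ∀ yz yr θ, k yz yr θ ^ 2 ≤
      (x.1 - yz) ^ 2 + (x.2 - yr) ^ 2 + 2 * x.2 * yr * (1 - Real.cos θ)) :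
    |∫ yz : ℝ, ∫ yr in Set.Ioi (0 : ℝ), ∫ θ in Set.Ioc (-Real.pi) Real.pi,
      yr ^ 2 * ω (yz, yr) * k yz yr θ /
        (((x.1 - yz) ^ 2 + (x.2 - yr) ^ 2 + 2 * x.2 * yr * (1 - Real.cos θ)) ^ ((3 : ℝ) / 2))| ≤
      66 * Real.pi ^ 2 * (Real.sqrt (∫ y in halfPlane, y.2 ^ 2 * |ω y|) * Real.sqrt L) := by
  have hπ := Real.pi_pos
  have hM : 0 ≤ ∫ y in halfPlane, y.2 ^ 2 * |ω y| := integral_nonneg fun y => by positivity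
  rw [show (66 : ℝ) * Real.pi ^ 2 = 2 * Real.pi ^ 2 * (1 + 32) by ring, mul_assoc,
    ← div_le_iff₀' (by positivity)]
  refine le_mul_sqrt_of_forall_le hM hL (by norm_num) fun s hs => ?_
  rw [div_le_iff₀' (by positivity)]
  refine (ENNReal.ofReal_le_ofReal_iff (by positivity)).1 ?_
  refine le_trans ?_ (lintegral_weighted_kernel_le hint hL hae hx hs)
  rw [lintegral_halfPlane (by fun_prop), ← Real.norm_eq_abs, ofReal_norm]
  refine (enorm_integral_le_lintegral_enorm _).trans (lintegral_mono_ae ?_)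
  filter_upwards [Measure.ae_ne volume x.1] with yz hyz
  refine (enorm_integral_le_lintegral_enorm _).trans
    (setLIntegral_mono' measurableSet_Ioi fun yr hyr => ?_)
  exact (enorm_integral_le_lintegral_enorm _).trans
    (lintegral_angular_le (sub_ne_zero.2 hyz.symm) hx hyr _ (hk yz yr))

/-- There is a universal constant `C > 0` such that the velocity field `u = (u_z, u_r)`
reconstructed from a bounded measurable potential vorticity `ω` with
`∫ y_r²·|ω| < ∞` by the axisymmetric Biot–Savart law satisfies
`|u(x)| ≤ C·(∫ y_r²·|ω|)^{1/2}·(ess sup |ω|)^{1/2}` on `ℝ²₊`. -/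
theorem stmt_9 :
    ∃ C > (0:ℝ), ∀ ω : ℝ × ℝ → ℝ, Measurable ω → (∃ B, ∀ y, |ω y| ≤ B) →
      IntegrableOn (fun y => y.2^2 * |ω y|) halfPlane →
      ∀ x : ℝ × ℝ, 0 < x.2 →
        Real.sqrt ((uzBS ω x)^2 + (urBS ω x)^2) ≤
          C * Real.sqrt (∫ y in halfPlane, y.2^2 * |ω y|) *
            Real.sqrt (essSup (fun y => (|ω y| : ℝ)) (volume.restrict halfPlane)) := by
  have hπ := Real.pi_pos
  refine ⟨33 * Real.pi, by positivity, fun ω hω ⟨B, hB⟩ hint x hx => ?_⟩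
  set L := essSup (fun y => (|ω y| : ℝ)) (volume.restrict halfPlane)
  have hae : ∀ᵐ y ∂volume.restrict halfPlane, |ω y| ≤ L :=
    ae_le_essSup (Filter.isBoundedUnder_of ⟨B, hB⟩)
  have hL : 0 ≤ L := by
    have : (volume.restrict halfPlane : Measure (ℝ × ℝ)) ≠ 0 := by
      rw [Ne, Measure.restrict_eq_zero]
      exact ((isOpen_lt continuous_const continuous_snd).measure_pos volume
        ⟨((0, 1) : ℝ × ℝ), by simp⟩).ne'
    have : (ae (volume.restrict halfPlane : Measure (ℝ × ℝ))).NeBot := ae_neBot.2 this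
    obtain ⟨y, hy⟩ := hae.exists
    exact (abs_nonneg _).trans hy
  set S := Real.sqrt (∫ y in halfPlane, y.2 ^ 2 * |ω y|)
  have hz : |uzBS ω x| ≤ 33 / 2 * Real.pi * (S * Real.sqrt L) := by
    have h := abs_integral_biotSavart_le hω hint hL hae hx
      (fun _ yr θ => x.2 * Real.cos θ - yr) fun yz yr θ => by
        nlinarith [sq_nonneg (x.1 - yz), mul_nonneg (sq_nonneg x.2) (sq_nonneg (Real.sin θ)),
          Real.sin_sq_add_cos_sq θ]
    rw [uzBS, abs_mul, abs_neg, abs_of_pos (by positivity : 0 < 1 / (4 * Real.pi))]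
    refine (mul_le_mul_of_nonneg_left h (by positivity)).trans_eq ?_
    simp only [S]
    field_simp
    ring
  have hr : |urBS ω x| ≤ 33 / 2 * Real.pi * (S * Real.sqrt L) := by
    have h := abs_integral_biotSavart_le hω hint hL hae hx
      (fun yz _ θ => (x.1 - yz) * Real.cos θ) fun yz yr θ => by
        nlinarith [sq_nonneg (yr - x.2 * Real.cos θ),
          mul_nonneg (sq_nonneg (x.1 - yz)) (sq_nonneg (Real.sin θ)),
          mul_nonneg (sq_nonneg x.2) (sq_nonneg (Real.sin θ)), Real.sin_sq_add_cos_sq θ]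
    simp only [← mul_assoc] at h
    rw [urBS, abs_mul, abs_of_pos (by positivity : 0 < 1 / (4 * Real.pi))]
    simp only [← mul_assoc]
    refine (mul_le_mul_of_nonneg_left h (by positivity)).trans_eq ?_
    simp only [S]
    field_simp
    ring
  have hS : 0 ≤ S * Real.sqrt L := by positivity
  refine (Real.sqrt_le_sqrt (?_ : _ ≤ (|uzBS ω x| + |urBS ω x|) ^ 2)).trans ?_
  · rw [add_sq, sq_abs, sq_abs]
    nlinarith [mul_nonneg (abs_nonneg (uzBS ω x)) (abs_nonneg (urBS ω x))]
  · rw [Real.sqrt_sq (by positivity)]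
    linarith
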